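/- For every numerical set H with H ≠ ℕ, one has t(H) ≤ g(H) + g(A(H)) − F(H), and equality holds if and only if T(H) is a numerical semigroup (i.e. T(H) is closed under addition). -/

import Mathlib

open scoped Classical

/-- A numerical set: a subset of ℕ containing 0 with finite complement. -/
def NumericalSet (H : Set ℕ) : Prop := 0 ∈ H ∧ Hᶜ.Finite

/-- A numerical semigroup: a numerical set closed under addition. -/
def NumericalSemigroup (S : Set ℕ) : Prop :=
  NumericalSet S ∧ ∀ a ∈ S, ∀ b ∈ S, a + b ∈ S

/-- Frobenius number: the largest gap. -/
noncomputable def frob (H : Set ℕ) : ℕ := sSup Hᶜ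

/-- Genus: the number of gaps. -/
noncomputable def genus (H : Set ℕ) : ℕ := Hᶜ.ncard

/-- Multiplicity: the smallest nonzero element. -/
noncomputable def mult (H : Set ℕ) : ℕ := sInf {x | x ∈ H ∧ x ≠ 0}

/-- The T-set of a numerical set.  (With truncated subtraction, every `x ≥ frob H`
satisfies `frob H - x = 0`, matching the convention that `F(H) - x` computed in ℤ
is nonpositive, hence not a nonzero element of `H`.) -/
def Tset (H : Set ℕ) : Set ℕ := {x | frob H - x ∉ H ∨ frob H - x = 0}

/-- The associated numerical semigroup of a numerical set. -/
def A (H : Set ℕ) : Set ℕ := {x | ∀ h ∈ H, x + h ∈ H}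

/-- `A*`-operation on numerical sets. -/
def Astar (H : Set ℕ) : Set ℕ := {a | ∀ h ∈ H, h ≠ 0 → a + h ∈ H}

/-- Pseudo-Frobenius numbers of a numerical set. -/
def PF (H : Set ℕ) : Set ℕ := {a | a ∉ H ∧ ∀ h ∈ H, h ≠ 0 → a + h ∈ H}

/-- Type of a numerical set. -/
noncomputable def typ (H : Set ℕ) : ℕ := (PF H).ncard

/-- Almost symmetric: `t(S) = 2 g(S) - F(S)`. -/
def AlmostSymmetric (S : Set ℕ) : Prop :=
  (typ S : ℤ) = 2 * (genus S : ℤ) - (frob S : ℤ)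

/-- An ordinary numerical set: `{0} ∪ {x : x > F(H)}`. -/
def Ordinary (H : Set ℕ) : Prop := H = insert 0 {x : ℕ | frob H < x}

theorem NumericalSet.frob_notMem {H : Set ℕ} (hH : NumericalSet H) (hne : H ≠ Set.univ) :
    frob H ∉ H :=
  Nat.sSup_mem (Set.nonempty_compl.2 hne) hH.2.bddAbove

theorem NumericalSet.mem_of_frob_lt {H : Set ℕ} (hH : NumericalSet H) {x : ℕ}
    (hx : frob H < x) : x ∈ H := by
  by_contra h
  exact absurd (le_csSup hH.2.bddAbove h) (not_le.2 hx)

theorem NumericalSet.finite_compl_A {H : Set ℕ} (hH : NumericalSet H) : (A H)ᶜ.Finite := by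
  refine (Set.finite_Iic (frob H)).subset fun x hx => ?_
  by_contra h
  rw [Set.mem_Iic, not_le] at h
  exact hx fun y _ => hH.mem_of_frob_lt (by omega)

theorem A_subset_Astar {H : Set ℕ} : A H ⊆ Astar H :=
  fun _ hx h hh _ => hx h hh

theorem NumericalSet.finite_compl_Astar {H : Set ℕ} (hH : NumericalSet H) :
    (Astar H)ᶜ.Finite :=
  hH.finite_compl_A.subset (Set.compl_subset_compl.2 A_subset_Astar)

theorem mem_compl_Tset {H : Set ℕ} {x : ℕ} :
    x ∈ (Tset H)ᶜ ↔ frob H - x ∈ H ∧ frob H - x ≠ 0 := by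
  simp [Tset]

theorem NumericalSet.Astar_subset_Tset {H : Set ℕ} (hH : NumericalSet H)
    (hne : H ≠ Set.univ) : Astar H ⊆ Tset H := by
  intro x hx
  by_contra h
  obtain ⟨h1, h2⟩ := mem_compl_Tset.1 h
  have := hx _ h1 h2
  rw [Nat.add_sub_cancel' (by omega)] at this
  exact hH.frob_notMem hne this

theorem NumericalSet.typ_add_ncard_compl_Astar {H : Set ℕ} (hH : NumericalSet H) :
    typ H + (Astar H)ᶜ.ncard = genus (A H) := by
  have hu : PF H ∪ (Astar H)ᶜ = (A H)ᶜ := by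
    ext x
    constructor
    · rintro (hx | hx) h
      · exact hx.1 (by simpa using h 0 hH.1)
      · exact hx (A_subset_Astar h)
    · intro hx
      by_cases h : x ∈ Astar H
      · refine Or.inl ⟨fun hxH => hx fun y hy => ?_, h⟩
        rcases eq_or_ne y 0 with rfl | hy0
        · simpa using hxH
        · exact h y hy hy0
      · exact Or.inr h
  have hd : Disjoint (PF H) (Astar H)ᶜ :=
    Set.disjoint_compl_right_iff_subset.2 fun _ hx => hx.2
  have hf : (PF H).Finite := hH.2.subset fun _ hx => hx.1
  rw [typ, genus, ← hu, Set.ncard_union_eq hd hf hH.finite_compl_Astar]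

theorem NumericalSet.ncard_compl_Tset_add_genus {H : Set ℕ} (hH : NumericalSet H) :
    (Tset H)ᶜ.ncard + genus H = frob H := by
  have hi : Set.InjOn (fun x => frob H - x) (Tset H)ᶜ := by
    intro x hx y hy hxy
    have := (mem_compl_Tset.1 hx).2
    simp only at hxy
    omega
  have hu : (fun x => frob H - x) '' (Tset H)ᶜ ∪ Hᶜ = Set.Icc 1 (frob H) := by
    ext x
    constructor
    · rintro (⟨y, hy, rfl⟩ | hx)
      · have := (mem_compl_Tset.1 hy).2
        simp only [Set.mem_Icc]
        omega
      · have h0 : x ≠ 0 := by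
          rintro rfl
          exact hx hH.1
        exact ⟨by omega, not_lt.1 fun h => hx (hH.mem_of_frob_lt h)⟩
    · rintro ⟨h1, h2⟩
      by_cases h : x ∈ H
      · have hx : frob H - (frob H - x) = x := by omega
        refine Or.inl ⟨frob H - x, mem_compl_Tset.2 ?_, hx⟩
        rw [hx]
        exact ⟨h, by omega⟩
      · exact Or.inr h
  have hd : Disjoint ((fun x => frob H - x) '' (Tset H)ᶜ) Hᶜ := by
    rw [Set.disjoint_compl_right_iff_subset]
    rintro _ ⟨y, hy, rfl⟩
    exact (mem_compl_Tset.1 hy).1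
  have hf := (Set.finite_Icc 1 (frob H)).subset (hu ▸ Set.subset_union_left)
  rw [genus, ← hi.ncard_image, ← Set.ncard_union_eq hd hf hH.2, hu,
    ← Finset.coe_Icc, Set.ncard_coe_finset]
  simp

theorem NumericalSet.numericalSet_Tset {H : Set ℕ} (hH : NumericalSet H) (hne : H ≠ Set.univ) :
    NumericalSet (Tset H) :=
  ⟨Or.inl (by simpa using hH.frob_notMem hne),
    hH.finite_compl_Astar.subset (Set.compl_subset_compl.2 (hH.Astar_subset_Tset hne))⟩

theorem NumericalSet.numericalSemigroup_Tset_iff {H : Set ℕ} (hH : NumericalSet H)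
    (hne : H ≠ Set.univ) : NumericalSemigroup (Tset H) ↔ Tset H ⊆ Astar H := by
  constructor
  · rintro ⟨-, hadd⟩ a ha h hh h0
    by_contra hn
    have hle : a + h ≤ frob H := not_lt.1 fun hlt => hn (hH.mem_of_frob_lt hlt)
    have hb : frob H - (a + h) ∈ Tset H := Or.inl (by rwa [Nat.sub_sub_self hle])
    have hx : frob H - (a + (frob H - (a + h))) = h := by omega
    rcases hadd a ha _ hb with hc | hc <;> rw [hx] at hc
    · exact hc hh
    · exact h0 hc
  · intro hsub
    refine ⟨hH.numericalSet_Tset hne, fun a ha b hb => ?_⟩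
    by_contra hc
    obtain ⟨h1, h2⟩ := mem_compl_Tset.1 hc
    have hm := hsub ha _ h1 h2
    rw [show a + (frob H - (a + b)) = frob H - b by omega] at hm
    exact mem_compl_Tset.2 ⟨hm, by omega⟩ hb

theorem stmt_9 (H : Set ℕ) (hH : NumericalSet H) (hne : H ≠ Set.univ) :
    (typ H : ℤ) ≤ (genus H : ℤ) + (genus (A H) : ℤ) - (frob H : ℤ) ∧
    ((typ H : ℤ) = (genus H : ℤ) + (genus (A H) : ℤ) - (frob H : ℤ) ↔
      NumericalSemigroup (Tset H)) := by
  have h1 := hH.typ_add_ncard_compl_Astar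
  have h2 := hH.ncard_compl_Tset_add_genus
  have hsub := Set.compl_subset_compl.2 (hH.Astar_subset_Tset hne)
  have hle := Set.ncard_le_ncard hsub hH.finite_compl_Astar
  refine ⟨by omega, ?_⟩
  rw [hH.numericalSemigroup_Tset_iff hne, ← Set.compl_subset_compl]
  constructor
  · intro h
    exact (Set.eq_of_subset_of_ncard_le hsub (by omega) hH.finite_compl_Astar).ge
  · intro h
    rw [h.antisymm hsub] at h1
    omega
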